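/- Let V be a finite-dimensional complex vector space and Λ(z) = Σ_{i=1}^k Λ_i z^{-i} a normal form (Λ_i pairwise commuting, Λ_2,…,Λ_k semisimple). Then there exists a scalar Laurent tail α(z) = Σ_{i=1}^k α_i z^{-i} with α_i ∈ ℂ such that dim Z(Λ) ≤ (dim V) · dim Ker(Λ_hat − α_hat), where Λ_hat and α_hat denote the associated block upper-triangular Toeplitz matrices on V^{⊕k} (α_hat built from α_i · Id_V) and Z(Λ) is the stabilizer of Λ in G_k(V). -/

import Mathlib

open Module

/-- The block upper-triangular Toeplitz matrix on `V^{⊕k}` built from 1-indexed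
coefficients `B_1, …, B_k`: `(i,j)`-block `B_{k-(j-i)}` for `i ≤ j`, zero below. -/
noncomputable def toepl (V : Type*) [AddCommGroup V] [Module ℂ V] (k : ℕ)
    (B : ℕ → Module.End ℂ V) : (Fin k → V) →ₗ[ℂ] (Fin k → V) :=
  LinearMap.pi fun i => ∑ j : Fin k,
    if (i : ℕ) ≤ (j : ℕ) then B (k - ((j : ℕ) - (i : ℕ))) ∘ₗ LinearMap.proj j else 0

/-- The linear map on `(g_0,…,g_{k-1})` whose kernel is the Lie algebra of the
stabilizer `Z(Λ) ⊆ G_k(V)`: the `l`-th component (0-indexed) is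
`Σ_{i : l+1+i ≤ k} (Λ_{l+1+i} g_i − g_i Λ_{l+1+i})`. -/
noncomputable def coadStab (V : Type*) [AddCommGroup V] [Module ℂ V]
    (k : ℕ) (Λ : ℕ → Module.End ℂ V) :
    (Fin k → Module.End ℂ V) →ₗ[ℂ] (Fin k → Module.End ℂ V) :=
  LinearMap.pi fun l => ∑ i : Fin k,
    if (l : ℕ) + 1 + (i : ℕ) ≤ k then
      (LinearMap.mulLeft ℂ (Λ ((l : ℕ) + 1 + (i : ℕ)))
        - LinearMap.mulRight ℂ (Λ ((l : ℕ) + 1 + (i : ℕ)))) ∘ₗ LinearMap.proj i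
    else 0

open Module

/-- A finite commuting family on a nontrivial space has a common eigenvector. -/
theorem aux_common_eigen {W : Type*} [AddCommGroup W] [Module ℂ W] [FiniteDimensional ℂ W]
    [Nontrivial W] (b : ℕ → Module.End ℂ W) (s : Finset ℕ)
    (hc : ∀ i ∈ s, ∀ j ∈ s, Commute (b i) (b j)) :
    ∃ (β : ℕ → ℂ) (w : W), w ≠ 0 ∧ ∀ i ∈ s, b i w = β i • w := by
  suffices h : ∀ t : Finset ℕ, t ⊆ s → ∃ (β : ℕ → ℂ) (w : W), w ≠ 0 ∧ ∀ i ∈ t, b i w = β i • w from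
    h s (Finset.Subset.refl s)
  intro t
  induction t using Finset.induction_on with
  | empty =>
    intro _
    obtain ⟨w, hw⟩ := exists_ne (0 : W)
    exact ⟨0, w, hw, by simp⟩
  | insert a t hat ih =>
    intro hts
    obtain ⟨β, w, hw0, hw⟩ := ih (fun x hx => hts (Finset.mem_insert_of_mem hx))
    let U : Submodule ℂ W := ⨅ i ∈ t, LinearMap.ker (b i - β i • (1 : Module.End ℂ W))
    have hU : ∀ x, x ∈ U ↔ ∀ i ∈ t, b i x = β i • x := by
      intro x
      simp [U, Submodule.mem_iInf, LinearMap.mem_ker, sub_eq_zero]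
    have hinv : ∀ x ∈ U, b a x ∈ U := by
      intro x hx
      rw [hU] at hx ⊢
      intro i hi
      have h := hc i (hts (Finset.mem_insert_of_mem hi)) a (hts (Finset.mem_insert_self a t))
      have h2 : b i (b a x) = b a (b i x) := congrArg (fun f : Module.End ℂ W => f x) h.eq
      rw [h2, hx i hi, map_smul]
    have : Nontrivial U := ⟨⟨w, (hU w).2 hw⟩, 0, fun h => hw0 (congrArg Subtype.val h)⟩
    obtain ⟨c, hcv⟩ := Module.End.exists_eigenvalue ((b a).restrict hinv)
    obtain ⟨v, hv⟩ := hcv.exists_hasEigenvector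
    refine ⟨Function.update β a c, v.1, fun h => hv.2 (Subtype.ext h), ?_⟩
    intro i hi
    rcases Finset.mem_insert.1 hi with rfl | hi
    · have := congrArg Subtype.val hv.apply_eq_smul
      simpa using this
    · have hne : i ≠ a := fun h => hat (h ▸ hi)
      rw [Function.update_of_ne hne]
      exact (hU v.1).1 v.2 i hi

/-- The intertwining map on `Hom(W,V)[z]/z^k`. -/
noncomputable def auxT (V : Type*) [AddCommGroup V] [Module ℂ V] (W : Type*) [AddCommGroup W]
    [Module ℂ W] (k : ℕ) (Λ : ℕ → Module.End ℂ V) (b : ℕ → Module.End ℂ W) :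
    (Fin k → (W →ₗ[ℂ] V)) →ₗ[ℂ] (Fin k → (W →ₗ[ℂ] V)) :=
  LinearMap.pi fun l => ∑ i : Fin k,
    if (l : ℕ) + 1 + (i : ℕ) ≤ k then
      (LinearMap.compRight ℂ (Λ ((l : ℕ) + 1 + (i : ℕ)))
        - LinearMap.lcomp ℂ V (b ((l : ℕ) + 1 + (i : ℕ)))) ∘ₗ LinearMap.proj i
    else 0

theorem auxT_apply {V : Type*} [AddCommGroup V] [Module ℂ V] {W : Type*} [AddCommGroup W]
    [Module ℂ W] (k : ℕ) (Λ : ℕ → Module.End ℂ V) (b : ℕ → Module.End ℂ W)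
    (g : Fin k → (W →ₗ[ℂ] V)) (l : Fin k) (w : W) :
    auxT V W k Λ b g l w = ∑ i : Fin k, if (l : ℕ) + 1 + (i : ℕ) ≤ k then
      Λ ((l : ℕ) + 1 + (i : ℕ)) (g i w) - g i (b ((l : ℕ) + 1 + (i : ℕ)) w) else 0 := by
  simp only [auxT, LinearMap.pi_apply, LinearMap.sum_apply]
  refine Finset.sum_congr rfl fun i _ => ?_
  split_ifs <;> simp

theorem toepl_apply_rev {V : Type*} [AddCommGroup V] [Module ℂ V] (k : ℕ)
    (B : ℕ → Module.End ℂ V) (x : Fin k → V) (l : Fin k) :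
    toepl V k B (fun j => x j.rev) l = ∑ i : Fin k, if (l : ℕ) + 1 + (i : ℕ) ≤ k then
      B ((l : ℕ) + 1 + (i : ℕ)) (x i) else 0 := by
  simp only [toepl, LinearMap.pi_apply, LinearMap.sum_apply]
  rw [← Equiv.sum_comp Fin.revPerm]
  refine Finset.sum_congr rfl fun i _ => ?_
  have hi := i.2
  have hl := l.2
  simp only [Fin.revPerm_apply, Fin.val_rev]
  by_cases h : (l : ℕ) + 1 + (i : ℕ) ≤ k
  · have h1 : (l : ℕ) ≤ k - ((i : ℕ) + 1) := by omega
    have h2 : k - (k - ((i : ℕ) + 1) - (l : ℕ)) = (l : ℕ) + 1 + (i : ℕ) := by omega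
    rw [if_pos h, if_pos h1, h2]
    simp
  · have h1 : ¬ (l : ℕ) ≤ k - ((i : ℕ) + 1) := by omega
    rw [if_neg h, if_neg h1]
    simp

theorem aux_bound (V : Type*) [AddCommGroup V] [Module ℂ V] [FiniteDimensional ℂ V]
    (k : ℕ) (Λ : ℕ → Module.End ℂ V) (m : ℕ)
    (hm : ∀ α : ℕ → ℂ,
      finrank ℂ ↥(LinearMap.ker (toepl V k (fun i => Λ i - α i • 1))) ≤ m) (n : ℕ) :
    ∀ (W : Type _) [AddCommGroup W] [Module ℂ W] [FiniteDimensional ℂ W]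
      (b : ℕ → Module.End ℂ W)
      (_ : ∀ i ∈ Finset.Icc 1 k, ∀ j ∈ Finset.Icc 1 k, Commute (b i) (b j))
      (_ : finrank ℂ W = n),
      finrank ℂ ↥(LinearMap.ker (auxT V W k Λ b)) ≤ n * m := by
  induction n with
  | zero =>
    intro W _ _ _ b _ h0
    have h1 := Submodule.finrank_le (LinearMap.ker (auxT V W k Λ b))
    have h2 : finrank ℂ (Fin k → (W →ₗ[ℂ] V)) = 0 := by
      rw [Module.finrank_pi_fintype]
      simp [Module.finrank_linearMap, h0]
    omega
  | succ n ih =>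
    intro W _ _ _ b hb hn
    have : Nontrivial W := Module.nontrivial_of_finrank_pos (R := ℂ) (by omega)
    obtain ⟨β, w, hw0, hw⟩ := aux_common_eigen b (Finset.Icc 1 k) hb
    let S : Submodule ℂ W := Submodule.span ℂ {w}
    have hS : finrank ℂ S = 1 := finrank_span_singleton hw0
    have hSq : finrank ℂ (W ⧸ S) = n := by
      have := Submodule.finrank_quotient_add_finrank S
      omega
    have hinv : ∀ i ∈ Finset.Icc 1 k, S ≤ S.comap (b i) := by
      intro i hi
      rw [Submodule.span_singleton_le_iff_mem, Submodule.mem_comap, hw i hi]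
      exact Submodule.smul_mem _ _ (Submodule.mem_span_singleton_self w)
    classical
    let b' : ℕ → Module.End ℂ (W ⧸ S) := fun i =>
      if h : i ∈ Finset.Icc 1 k then S.mapQ S (b i) (hinv i h) else 0
    have hb'a : ∀ i ∈ Finset.Icc 1 k, ∀ x, b' i (S.mkQ x) = S.mkQ (b i x) := by
      intro i hi x
      simp only [b', dif_pos hi]
      exact Submodule.mapQ_apply S S (b i) x
    have hb' : ∀ i ∈ Finset.Icc 1 k, ∀ j ∈ Finset.Icc 1 k, Commute (b' i) (b' j) := by
      intro i hi j hj
      refine LinearMap.ext fun y => ?_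
      obtain ⟨x, rfl⟩ := S.mkQ_surjective y
      rw [Module.End.mul_apply, Module.End.mul_apply, hb'a j hj, hb'a i hi, hb'a i hi, hb'a j hj]
      exact congrArg (fun f : Module.End ℂ W => S.mkQ (f x)) (hb i hi j hj).eq
    have hIH := ih (W ⧸ S) b' hb' hSq
    let K := LinearMap.ker (auxT V W k Λ b)
    let ev : (Fin k → (W →ₗ[ℂ] V)) →ₗ[ℂ] (Fin k → V) :=
      LinearMap.pi fun j => LinearMap.applyₗ w ∘ₗ LinearMap.proj j.rev
    have hev : ∀ g, ev g = fun j => (fun i => g i w) j.rev := fun g => rfl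
    let pre : (Fin k → ((W ⧸ S) →ₗ[ℂ] V)) →ₗ[ℂ] (Fin k → (W →ₗ[ℂ] V)) :=
      LinearMap.pi fun j => LinearMap.lcomp ℂ V S.mkQ ∘ₗ LinearMap.proj j
    have hpre : ∀ g j x, pre g j x = g j (S.mkQ x) := fun g j x => rfl
    let f := ev.domRestrict K
    have hrange : LinearMap.range f ≤
        LinearMap.ker (toepl V k (fun i => Λ i - β i • 1)) := by
      rintro _ ⟨⟨g, hg⟩, rfl⟩
      rw [LinearMap.mem_ker]
      funext l
      change toepl V k (fun i => Λ i - β i • 1) (ev g) l = 0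
      rw [hev]
      refine (toepl_apply_rev k (fun i => Λ i - β i • 1) (fun i => g i w) l).trans ?_
      have h0 : auxT V W k Λ b g l w = 0 := by
        rw [LinearMap.mem_ker.1 hg]; rfl
      rw [auxT_apply] at h0
      refine Eq.trans (Finset.sum_congr rfl fun i _ => ?_) h0
      split_ifs with h
      · rw [hw _ (Finset.mem_Icc.2 ⟨by omega, h⟩)]
        simp
      · rfl
    have hker : (LinearMap.ker f).map K.subtype ≤
        (LinearMap.ker (auxT V (W ⧸ S) k Λ b')).map pre := by
      rintro _ ⟨⟨g, hg⟩, hgf, rfl⟩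
      have hgw : ∀ i, g i w = 0 := by
        intro i
        have h1 : ev g = 0 := hgf
        have h2 := congrFun h1 i.rev
        rw [hev] at h2
        simpa using h2
      have hle : ∀ i, S ≤ LinearMap.ker (g i) := by
        intro i
        rw [Submodule.span_singleton_le_iff_mem]
        exact hgw i
      refine ⟨fun i => S.liftQ (g i) (hle i), ?_, ?_⟩
      · change _ ∈ LinearMap.ker _
        rw [LinearMap.mem_ker]
        funext l
        refine LinearMap.ext fun y => ?_
        obtain ⟨x, rfl⟩ := S.mkQ_surjective y
        have h0 : auxT V W k Λ b g l x = 0 := by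
          rw [LinearMap.mem_ker.1 hg]; rfl
        rw [auxT_apply] at h0 ⊢
        refine Eq.trans (Finset.sum_congr rfl fun i _ => ?_) h0
        split_ifs with h
        · rw [hb'a _ (Finset.mem_Icc.2 ⟨by omega, h⟩)]
          simp
        · rfl
      · funext i
        refine LinearMap.ext fun x => ?_
        rw [hpre]
        simp
    have h1 := LinearMap.finrank_range_add_finrank_ker f
    have h2 := Submodule.finrank_mono hrange
    have h3 := hm β
    have h4 := Submodule.finrank_mono hker
    have h5 := Submodule.finrank_map_le pre (LinearMap.ker (auxT V (W ⧸ S) k Λ b'))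
    have h6 : finrank ℂ ((LinearMap.ker f).map K.subtype) = finrank ℂ (LinearMap.ker f) :=
      (Submodule.equivMapOfInjective K.subtype K.injective_subtype (LinearMap.ker f)).finrank_eq.symm
    change finrank ℂ K ≤ _
    rw [Nat.succ_mul]
    omega

/-- for a normal form `Λ(z) = Σ_{i=1}^k Λ_i z^{-i}` (pairwise commuting
coefficients, `Λ_2,…,Λ_k` semisimple), there is a scalar tail `α(z) = Σ α_i z^{-i}` with
`dim Z(Λ) ≤ (dim V) · dim Ker(Λ̂ − α̂)`, where hats denote the associated block
upper-triangular Toeplitz matrices on `V^{⊕k}`. -/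
theorem stmt18
    (V : Type*) [AddCommGroup V] [Module ℂ V] [FiniteDimensional ℂ V] [Nontrivial V]
    (k : ℕ) (hk : 0 < k) (Λ : ℕ → Module.End ℂ V)
    (hc : ∀ i j, 1 ≤ i → i ≤ k → 1 ≤ j → j ≤ k → Commute (Λ i) (Λ j))
    (hs : ∀ i, 2 ≤ i → i ≤ k → (Λ i).IsSemisimple) :
    ∃ α : ℕ → ℂ,
      finrank ℂ ↥(LinearMap.ker (coadStab V k Λ)) ≤
        finrank ℂ V *
          finrank ℂ ↥(LinearMap.ker (toepl V k (fun i => Λ i - α i • 1))) := by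
  obtain ⟨α, hα⟩ : ∃ α : ℕ → ℂ, ∀ β : ℕ → ℂ,
      finrank ℂ ↥(LinearMap.ker (toepl V k (fun i => Λ i - β i • 1))) ≤
      finrank ℂ ↥(LinearMap.ker (toepl V k (fun i => Λ i - α i • 1))) := by
    let F : (ℕ → ℂ) → ℕ := fun β =>
      finrank ℂ ↥(LinearMap.ker (toepl V k (fun i => Λ i - β i • 1)))
    have hbdd : BddAbove (Set.range F) := by
      refine ⟨finrank ℂ (Fin k → V), ?_⟩
      rintro _ ⟨β, rfl⟩
      exact Submodule.finrank_le _
    obtain ⟨α, hα⟩ := Nat.sSup_mem (Set.range_nonempty F) hbdd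
    refine ⟨α, fun β => ?_⟩
    change F β ≤ F α
    rw [hα]
    exact le_csSup hbdd ⟨β, rfl⟩
  refine ⟨α, ?_⟩
  have h := aux_bound V k Λ _ hα (finrank ℂ V) V Λ (by
    intro i hi j hj
    rw [Finset.mem_Icc] at hi hj
    exact hc i j hi.1 hi.2 hj.1 hj.2) rfl
  exact h
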